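/- arXiv:1909.13388 — 2 statements merged into one kernel-verified Lean document; each statement's English description precedes it below -/
import Mathlib

section
/- Let n ≥ 2 and 2 ≤ m ≤ n with n − m even. Then the number of ordered pairs (u, v) of n-cycles on [n] such that the elements 1, …, m lie in pairwise distinct cycles of the product u∘v equals ((n−1)!)² · ( 1/m! + 2/((m−2)!·(n+1−m)·(n+m)) ), as an identity of rational numbers. In particular, the probability that the product of two independent uniformly random n-cycles separates [m] is 1/m! + 2/((m−2)!(n+1−m)(n+m)) in this case. -/
open Equiv Finset

noncomputable section

/-- The number of cycles of a permutation of `Fin n`, counting fixed points as cycles. -/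
def cycleCount {n : ℕ} (σ : Equiv.Perm (Fin n)) : ℕ :=
  σ.cycleType.card + (Finset.univ.filter fun x => σ x = x).card

/-- A permutation of `Fin n` consisting of a single cycle of length `n`
(equivalently, having exactly one cycle, fixed points counting as cycles). -/
def IsFullCycle {n : ℕ} (σ : Equiv.Perm (Fin n)) : Prop :=
  cycleCount σ = 1

/-- `σ` separates the first `m` elements (`1, …, m`, i.e. indices `0, …, m-1`):
they lie in pairwise distinct cycles of `σ`. -/
def Separates {n : ℕ} (m : ℕ) (σ : Equiv.Perm (Fin n)) : Prop :=
  ∀ i j : Fin n, (i : ℕ) < m → (j : ℕ) < m → i ≠ j → ¬ σ.SameCycle i j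

/-- `C_m(N, k)`: the number of permutations of `[N]` with exactly `k` cycles
that separate the first `m` elements. -/
def sepCount (N m k : ℕ) : ℕ :=
  Nat.card {σ : Equiv.Perm (Fin N) // cycleCount σ = k ∧ Separates m σ}

/-- `C(N, k)`: the signless Stirling number of the first kind, i.e. the number of
permutations of `[N]` with exactly `k` cycles (fixed points counting as cycles). -/
def stirlingCycle (N k : ℕ) : ℕ :=
  Nat.card {σ : Equiv.Perm (Fin N) // cycleCount σ = k}

set_option linter.unusedSectionVars false
set_option linter.unusedSimpArgs false

section SepHelpers

open scoped Classical

variable {Y : Type} [Fintype Y] [DecidableEq Y]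

def FC (g : Perm Y) : Prop := ∀ s t, g.SameCycle s t

def NC (g : Perm Y) (x : Y) : Prop := g x = x ∧ ∀ s t, s ≠ x → t ≠ x → g.SameCycle s t

def SepM (M : Finset Y) (g : Perm Y) : Prop := ∀ i ∈ M, ∀ j ∈ M, i ≠ j → ¬ g.SameCycle i j

lemma sameCycle_lift {Z : Type} (g : Perm Y) (h : Perm Z) (f : Y → Z)
    (H : ∀ s, h.SameCycle (f s) (f (g s))) {s t : Y} (hst : g.SameCycle s t) :
    h.SameCycle (f s) (f t) := by
  obtain ⟨i, rfl⟩ := hst.exists_nat_pow_eq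
  induction i with
  | zero => exact Perm.SameCycle.refl _ _
  | succ k ih =>
    have := ih ⟨k, by simp⟩
    rw [pow_succ', Perm.mul_apply]
    exact this.trans (H _)

lemma removal (g d : Perm Y) (y : Y) (hd : d = swap y (g y) * g) {s t : Y} (hs : s ≠ y)
    (ht : t ≠ y) : d.SameCycle s t ↔ g.SameCycle s t := by
  subst hd
  constructor
  · intro h
    refine sameCycle_lift _ g id (fun s => ?_) h
    simp only [id, Perm.mul_apply]
    by_cases h1 : g s = y
    · rw [h1, swap_apply_left]
      refine ⟨2, ?_⟩
      rw [zpow_ofNat, pow_two, Perm.mul_apply, h1]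
    · by_cases h2 : g s = g y
      · rw [h2, swap_apply_right, g.injective h2]
      · rw [swap_apply_of_ne_of_ne h1 h2]
        exact ⟨1, by simp⟩
  · intro h
    have := sameCycle_lift g (swap y (g y) * g) (fun s => if s = y then g y else s) (fun s => ?_) h
    · simpa [hs, ht] using this
    · by_cases h0 : s = y
      · subst h0
        by_cases h1 : g s = s <;> simp [h1, Perm.SameCycle.refl]
      · by_cases h1 : g s = y
        · simp only [h0, h1, if_true, if_false]
          exact ⟨1, by simp [h1]⟩
        · have h2 : g s ≠ g y := fun h => h0 (g.injective h)
          simp only [h0, h1, if_false]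
          exact ⟨1, by simp [swap_apply_of_ne_of_ne h1 h2]⟩

lemma fc_iff_nc (g d : Perm Y) (y : Y) (hd : d = swap y (g y) * g) (hy : g y ≠ y) :
    FC g ↔ NC d y := by
  constructor
  · intro h
    refine ⟨by simp [hd], fun s t hs ht => (removal g d y hd hs ht).2 (h s t)⟩
  · rintro ⟨-, h⟩
    have key : ∀ s, g.SameCycle s (g y) := by
      intro s
      by_cases hs : s = y
      · subst hs; exact ⟨1, by simp⟩
      · exact (removal g d y hd hs hy).1 (h _ _ hs hy)
    intro s t
    exact (key s).trans (key t).symm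

/-- insertion -/
lemma fc_insert (b : Perm Y) (x j : Y) (hj : j ≠ x) (h : NC b x) : FC (swap x j * b) := by
  have h1 : (swap x j * b) x = j := by simp [h.1]
  refine (fc_iff_nc (swap x j * b) b x ?_ (by rw [h1]; exact hj)).2 h
  rw [h1, ← mul_assoc, swap_mul_self, one_mul]

lemma nc_remove (g : Perm Y) (y : Y) (hy : g y ≠ y) (h : FC g) : NC (swap y (g y) * g) y :=
  (fc_iff_nc g _ y rfl hy).1 h

lemma nc_conj (t b : Perm Y) (x : Y) : NC (t * b * t⁻¹) (t x) ↔ NC b x := by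
  unfold NC
  refine and_congr (by simp) ?_
  constructor
  · intro h s u hs hu
    have := h (t s) (t u) (by simpa using hs) (by simpa using hu)
    simpa [Perm.sameCycle_conj] using this
  · intro h s u hs hu
    rw [Perm.sameCycle_conj]
    exact h _ _ (fun e => hs (by simp [← e])) (fun e => hu (by simp [← e]))

lemma fc_conj (t b : Perm Y) : FC (t * b * t⁻¹) ↔ FC b := by
  unfold FC
  constructor
  · intro h s u
    have := h (t s) (t u)
    simpa [Perm.sameCycle_conj] using this
  · intro h s u
    rw [Perm.sameCycle_conj]
    exact h _ _

lemma sep_conj (t b : Perm Y) (M : Finset Y) : SepM (M.image t) (t * b * t⁻¹) ↔ SepM M b := by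
  unfold SepM
  simp only [Finset.forall_mem_image, Perm.sameCycle_conj]
  simp

/-- restricted sign -/
def eps (g : Perm Y) (S : Finset Y) : ℤ :=
  if h : ∀ x, g x ∈ S ↔ x ∈ S then ((Perm.sign (g.subtypePerm h) : ℤˣ) : ℤ) else 0

lemma inv_iff (g : Perm Y) (S : Finset Y) : (∀ x, g x ∈ S ↔ x ∈ S) ↔ ∀ x ∈ S, g x ∈ S := by
  constructor
  · intro h x hx; exact (h x).2 hx
  · intro h x
    refine ⟨fun hx => ?_, h x⟩
    have : S.image g = S := Finset.eq_of_subset_of_card_le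
      (by intro y hy; obtain ⟨z, hz, rfl⟩ := Finset.mem_image.1 hy; exact h z hz)
      (by rw [Finset.card_image_of_injective _ g.injective])
    rw [← this] at hx
    obtain ⟨z, hz, e⟩ := Finset.mem_image.1 hx
    rwa [← g.injective e]

lemma eps_zero (g : Perm Y) (S : Finset Y) (h : ¬ ∀ x ∈ S, g x ∈ S) : eps g S = 0 := by
  rw [eps, dif_neg]; rwa [inv_iff]

lemma eps_eq (g : Perm Y) (S : Finset Y) (h : ∀ x ∈ S, g x ∈ S) (w : Perm Y)
    (h1 : ∀ x ∈ S, w x = g x) (h2 : ∀ x, x ∉ S → w x = x) : eps g S = (Perm.sign w : ℤˣ) := by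
  have h' := (inv_iff g S).2 h
  rw [eps, dif_pos h']
  have : w = Perm.ofSubtype (g.subtypePerm h') := by
    ext x
    by_cases hx : x ∈ S
    · rw [Perm.ofSubtype_apply_of_mem _ hx, h1 x hx]; rfl
    · rw [Perm.ofSubtype_apply_of_not_mem _ hx, h2 x hx]
  rw [this, Perm.sign_ofSubtype]

lemma exists_restr (g : Perm Y) (S : Finset Y) (h : ∀ x ∈ S, g x ∈ S) :
    ∃ w : Perm Y, (∀ x ∈ S, w x = g x) ∧ (∀ x, x ∉ S → w x = x) := by
  have h' := (inv_iff g S).2 h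
  refine ⟨Perm.ofSubtype (g.subtypePerm h'), fun x hx => ?_, fun x hx => ?_⟩
  · rw [Perm.ofSubtype_apply_of_mem _ hx]; rfl
  · rw [Perm.ofSubtype_apply_of_not_mem _ hx]

lemma swap_mem {S : Finset Y} {a b : Y} (ha : a ∈ S) (hb : b ∈ S) {x : Y} (hx : x ∈ S) :
    swap a b x ∈ S := by
  rw [Equiv.swap_apply_def]; split_ifs <;> assumption

lemma eps_flip (g g' : Perm Y) (S : Finset Y) (a b : Y) (hab : a ≠ b) (ha : a ∈ S) (hb : b ∈ S)
    (h : ∀ x ∈ S, g' x = g (swap a b x)) : eps g' S = - eps g S := by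
  by_cases hg : ∀ x ∈ S, g x ∈ S
  · obtain ⟨w, w1, w2⟩ := exists_restr g S hg
    rw [eps_eq g S hg w w1 w2, eps_eq g' S (fun x hx => by rw [h x hx]; exact hg _ (swap_mem ha hb hx))
      (w * swap a b)]
    · simp [Perm.sign_swap hab]
    · intro x hx
      rw [h x hx, Perm.mul_apply, w1 _ (swap_mem ha hb hx)]
    · intro x hx
      rw [Perm.mul_apply, swap_apply_of_ne_of_ne (by rintro rfl; exact hx ha)
        (by rintro rfl; exact hx hb), w2 x hx]
  · rw [eps_zero g S hg, eps_zero, neg_zero]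
    intro hg'
    apply hg
    intro x hx
    have := hg' _ (swap_mem ha hb hx)
    rw [h _ (swap_mem ha hb hx), swap_apply_self] at this
    exact this

lemma cyc_sign (g : Perm Y) (s : Y) (C : Finset Y) (hC : ∀ t, t ∈ C ↔ g.SameCycle s t) :
    (-1 : ℤ) ^ C.card * ((Perm.sign (g.cycleOf s) : ℤˣ) : ℤ) = -1 := by
  by_cases h : g s = s
  · have : C = {s} := by
      ext t
      rw [hC, Finset.mem_singleton]
      constructor
      · rintro ⟨i, rfl⟩; exact Perm.zpow_apply_eq_self_of_apply_eq_self h i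
      · rintro rfl; exact Perm.SameCycle.refl _ _
    rw [this, (Perm.cycleOf_eq_one_iff g).2 h]
    simp
  · have : C = (g.cycleOf s).support := by
      ext t
      rw [hC, Perm.mem_support_cycleOf_iff' h]
    rw [(Perm.isCycle_cycleOf g h).sign, this]
    push_cast
    rw [mul_neg, ← mul_pow]; simp

lemma eps_union (g : Perm Y) (s : Y) (C S : Finset Y) (hC : ∀ t, t ∈ C ↔ g.SameCycle s t)
    (hd : Disjoint S C) (hS : ∀ x ∈ S, g x ∈ S) :
    (-1 : ℤ) ^ (S ∪ C).card * eps g (S ∪ C) = - ((-1 : ℤ) ^ S.card * eps g S) := by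
  obtain ⟨w, w1, w2⟩ := exists_restr g S hS
  have hCi : ∀ x ∈ C, g x ∈ C := by
    intro x hx; rw [hC] at *; exact hx.apply_right
  rw [eps_eq g S hS w w1 w2, eps_eq g (S ∪ C) _ (w * g.cycleOf s), Finset.card_union_of_disjoint hd]
  · have := cyc_sign g s C hC
    rw [pow_add, Perm.sign_mul]
    push_cast
    linear_combination ((-1 : ℤ) ^ S.card * ((Perm.sign w : ℤˣ) : ℤ)) * this
  · intro x hx
    rw [Perm.mul_apply]
    by_cases hxC : x ∈ C
    · rw [((hC x).1 hxC).cycleOf_apply, w2]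
      exact Finset.disjoint_right.1 hd (hCi x hxC)
    · rw [Perm.cycleOf_apply_of_not_sameCycle (fun h => hxC ((hC x).2 h))]
      exact w1 x ((Finset.mem_union.1 hx).resolve_right hxC)
  · intro x hx
    rw [Finset.mem_union, not_or] at hx
    rw [Perm.mul_apply, Perm.cycleOf_apply_of_not_sameCycle (fun h => hx.2 ((hC x).2 h)), w2 x hx.1]
  · intro x hx
    rcases Finset.mem_union.1 hx with h | h
    · exact Finset.mem_union_left _ (hS x h)
    · exact Finset.mem_union_right _ (hCi x h)

lemma eps_symmDiff (g : Perm Y) (s : Y) (C S : Finset Y) (hC : ∀ t, t ∈ C ↔ g.SameCycle s t) :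
    (-1 : ℤ) ^ (symmDiff S C).card * eps g (symmDiff S C) = - ((-1 : ℤ) ^ S.card * eps g S) := by
  have hCi : ∀ x, g x ∈ C ↔ x ∈ C := by
    intro x; rw [hC, hC]; exact Perm.sameCycle_apply_right
  by_cases hS : ∀ x ∈ S, g x ∈ S
  · have hS' := (inv_iff g S).2 hS
    by_cases hs : s ∈ S
    · have hsub : C ⊆ S := by
        intro t ht
        obtain ⟨i, hi⟩ := ((hC t).1 ht).exists_nat_pow_eq
        rw [← hi]
        clear hi
        induction i with
        | zero => exact hs
        | succ k ih => rw [pow_succ', Perm.mul_apply]; exact hS _ ih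
      have h1 : symmDiff S C = S \ C := by
        rw [symmDiff_def]; simp [Finset.sdiff_eq_empty_iff_subset.2 hsub]
      have h2 : S = (S \ C) ∪ C := by rw [Finset.sdiff_union_of_subset hsub]
      rw [h1]
      have := eps_union g s C (S \ C) hC Finset.sdiff_disjoint (by
        intro x hx
        rw [Finset.mem_sdiff] at *
        rw [hS', hCi]; exact hx)
      rw [← h2] at this
      rw [this, neg_neg]
    · have hd : Disjoint S C := by
        rw [Finset.disjoint_left]
        intro t htS ht
        apply hs
        obtain ⟨i, hi⟩ := ((hC t).1 ht).symm.exists_nat_pow_eq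
        rw [← hi]
        clear hi
        induction i with
        | zero => exact htS
        | succ k ih => rw [pow_succ', Perm.mul_apply]; exact hS _ ih
      have h1 : symmDiff S C = S ∪ C := by
        rw [hd.symmDiff_eq_sup]; rfl
      rw [h1]
      exact eps_union g s C S hC hd hS
  · rw [eps_zero g S hS, eps_zero]
    · simp
    · intro h
      apply hS
      rw [← inv_iff] at h ⊢
      intro x
      have := h x
      rw [Finset.mem_symmDiff, Finset.mem_symmDiff, hCi] at this
      tauto

lemma eps_empty (g : Perm Y) : eps g ∅ = 1 := by
  rw [eps_eq g ∅ (by simp) 1 (by simp) (by simp)]; simp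

lemma eps_singleton (g : Perm Y) (s : Y) : eps g {s} = if g s = s then 1 else 0 := by
  split_ifs with h
  · rw [eps_eq g {s} (by simpa using h) 1 (by simpa using h.symm) (by simp)]; simp
  · rw [eps_zero]; simpa using h

lemma tree (g : Perm Y) (r : Y) :
    ∑ S : Finset Y with r ∉ S, (-1 : ℤ) ^ S.card * eps g S = if FC g then 1 else 0 := by
  split_ifs with h
  · rw [Finset.sum_eq_single ∅]
    · simp [eps_empty]
    · intro S hS hne
      rw [Finset.mem_filter] at hS
      rw [eps_zero, mul_zero]
      intro hi
      obtain ⟨s, hs⟩ := Finset.nonempty_iff_ne_empty.2 hne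
      apply hS.2
      obtain ⟨i, hi'⟩ := (h s r).exists_nat_pow_eq
      rw [← hi']
      clear hi'
      induction i with
      | zero => exact hs
      | succ k ih => rw [pow_succ', Perm.mul_apply]; exact hi _ ih
    · simp
  · obtain ⟨s, hs⟩ : ∃ s, ¬ g.SameCycle s r := by
      by_contra! hc
      exact h fun a b => (hc a).trans (hc b).symm
    set C : Finset Y := univ.filter fun t => g.SameCycle s t with hCd
    have hC : ∀ t, t ∈ C ↔ g.SameCycle s t := by simp [hCd]
    refine Finset.sum_involution (fun S _ => symmDiff S C) ?_ ?_ ?_ ?_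
    · intro S _
      rw [eps_symmDiff g s C S hC]; ring
    · intro S _ _ he
      have : C = ∅ := by simpa using he
      have h2 := (hC s).2 (Perm.SameCycle.refl _ _)
      simp [this] at h2
    · intro S hS
      have : r ∉ C := by rw [hC]; exact hs
      simp only [Finset.mem_filter, Finset.mem_univ, true_and, Finset.mem_symmDiff] at *
      tauto
    · intro S _
      simp

lemma nat_inv {g : Perm Y} {P : Y → Prop} (hP : ∀ t, P t → P (g t)) {s t : Y}
    (h : g.SameCycle s t) (hs : P s) : P t := by
  obtain ⟨i, rfl⟩ := h.exists_nat_pow_eq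
  clear h
  induction i with
  | zero => exact hs
  | succ k ih => rw [pow_succ', Perm.mul_apply]; exact hP _ ih

def NCs (Y : Type) [Fintype Y] [DecidableEq Y] : Finset (Y × Perm Y) :=
  univ.filter fun p => NC p.2 p.1

/-- one-sided step of the involution -/
lemma step (U : Y → Prop) (b : Perm Y) (x u v c : Y) (hu : U u) (hv : ¬ U v)
    (hg : ∀ t, U t ↔ (U (b t) ∧ b t ≠ u) ∨ b t = v) (hb : NC b x) (hx : U x)
    (hc : ¬ U c) (hcv : c ≠ v) :
    ¬ U (b⁻¹ u) ∧ b⁻¹ u ≠ v ∧ NC (swap (b⁻¹ u) u * (swap x v * b)) (b⁻¹ u) ∧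
    (∀ t, U t ↔ (U ((swap (b⁻¹ u) u * (swap x v * b)) t) ∧
      (swap (b⁻¹ u) u * (swap x v * b)) t ≠ u) ∨ (swap (b⁻¹ u) u * (swap x v * b)) t = v) ∧
    (swap (b⁻¹ u) u * (swap x v * b))⁻¹ v = x ∧ x ≠ u := by
  have huv : u ≠ v := by rintro rfl; exact hv hu
  have hxv : x ≠ v := by rintro rfl; exact hv hx
  have hxu : x ≠ u := by
    rintro rfl
    have := (hg x).1 hx
    rw [hb.1] at this
    tauto
  obtain ⟨y, hy⟩ : ∃ y, y = b⁻¹ u := ⟨_, rfl⟩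
  have hby : b y = u := by rw [hy]; simp
  rw [← hy]
  have hyU : ¬ U y := by
    rw [hg y, hby]; tauto
  have hyu : y ≠ u := by rintro rfl; exact hyU hu
  have hyx : y ≠ x := by rintro rfl; exact hyU hx
  have hyv : y ≠ v := by
    rintro rfl
    have h1 : b.SameCycle c u := hb.2 c u (by rintro rfl; exact hc hx) hxu.symm
    have := nat_inv (P := fun t => ¬ U t ∧ t ≠ y) (fun t ht => by
      have h2 := hg t
      have h3 : b t ≠ u := by
        intro e; exact ht.2 (b.injective (e.trans hby.symm))
      constructor
      · intro h4; exact ht.1 (h2.2 (Or.inl ⟨h4, h3⟩))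
      · intro h4; exact ht.1 (h2.2 (Or.inr h4))) h1 ⟨hc, hcv⟩
    exact this.1 hu
  refine ⟨hyU, hyv, ?_, ?_, ?_, hxu⟩
  · have h1 : FC (swap x v * b) := fc_insert b x v hxv.symm hb
    have h2 : (swap x v * b) y = u := by
      rw [Perm.mul_apply, hby, swap_apply_of_ne_of_ne hxu.symm huv]
    have h3 := nc_remove _ y (by rw [h2]; exact hyu.symm) h1
    rwa [h2] at h3
  · intro t
    rw [hg t, Perm.mul_apply, Perm.mul_apply]
    generalize b t = z
    by_cases z1 : z = x
    · subst z1
      rw [swap_apply_left, swap_apply_of_ne_of_ne hyv.symm huv.symm]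
      tauto
    by_cases z2 : z = v
    · subst z2
      rw [swap_apply_right, swap_apply_of_ne_of_ne hyx.symm hxu]
      tauto
    rw [swap_apply_of_ne_of_ne z1 z2]
    by_cases z3 : z = y
    · subst z3
      rw [swap_apply_left]
      tauto
    by_cases z4 : z = u
    · subst z4
      rw [swap_apply_right]
      tauto
    rw [swap_apply_of_ne_of_ne z3 z4]
  · rw [Perm.inv_eq_iff_eq, Perm.mul_apply, Perm.mul_apply, hb.1, swap_apply_left,
      swap_apply_of_ne_of_ne hyv.symm huv.symm]

lemma good_iff (σ b : Perm Y) (S : Finset Y) :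
    (∀ x ∈ S, (σ * b⁻¹) x ∈ S) ↔ ∀ t, σ t ∈ S ↔ b t ∈ S := by
  rw [← inv_iff]
  constructor
  · intro h t
    have := h (b t)
    simpa using this
  · intro h x
    have := h (b⁻¹ x)
    simpa using this

lemma vanish (σ : Perm Y) (S : Finset Y) (h2 : 2 ≤ S.card) (h3 : S.card + 2 ≤ Fintype.card Y) :
    ∑ p ∈ NCs Y, eps (σ * p.2⁻¹) S = 0 := by
  obtain ⟨T, hTd⟩ : ∃ T : Finset Y, T = S.image (σ⁻¹ : Perm Y) := ⟨_, rfl⟩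
  have hT : ∀ t, σ t ∈ S ↔ t ∈ T := by
    intro t
    rw [hTd, Finset.mem_image]
    constructor
    · intro h; exact ⟨σ t, h, by simp⟩
    · rintro ⟨s, hs, rfl⟩; simpa using hs
  have hcard : T.card = S.card := by rw [hTd, Finset.card_image_of_injective _ (Equiv.injective _)]
  have hcomm : (T \ S).card = (S \ T).card := Finset.card_sdiff_comm hcard
  rcases Nat.lt_trichotomy (T \ S).card 1 with hlt | heq | hgt
  · -- T = S
    have hsub : T ⊆ S := by
      rw [← Finset.sdiff_eq_empty_iff_subset, ← Finset.card_eq_zero]; omega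
    have hTS : T = S := Finset.eq_of_subset_of_card_le hsub hcard.ge
    refine Finset.sum_eq_zero fun p hp => eps_zero _ _ fun hgood => ?_
    rw [good_iff] at hgood
    simp only [hT, hTS] at hgood
    have hp := (Finset.mem_filter.1 hp).2
    obtain ⟨s, hs, hsx⟩ := Finset.exists_mem_ne (by omega : 1 < S.card) p.1
    obtain ⟨t, ht, htx⟩ := Finset.exists_mem_ne
      (by rw [Finset.card_compl]; omega : 1 < Sᶜ.card) p.1
    have := nat_inv (P := fun t => t ∈ S) (fun t h => (hgood t).1 h) (hp.2 s t hsx htx) hs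
    exact Finset.mem_compl.1 ht this
  · obtain ⟨a, ha⟩ := Finset.card_eq_one.1 heq
    obtain ⟨b, hb⟩ := Finset.card_eq_one.1 (hcomm ▸ heq)
    have ha1 : a ∈ T ∧ a ∉ S := by rw [← Finset.mem_sdiff, ha]; simp
    have hb1 : b ∈ S ∧ b ∉ T := by rw [← Finset.mem_sdiff, hb]; simp
    have ha2 : ∀ z, z ∈ T → z ∉ S → z = a := fun z h h' => by
      rw [← Finset.mem_singleton, ← ha, Finset.mem_sdiff]; exact ⟨h, h'⟩
    have hb2 : ∀ z, z ∈ S → z ∉ T → z = b := fun z h h' => by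
      rw [← Finset.mem_singleton, ← hb, Finset.mem_sdiff]; exact ⟨h, h'⟩
    have hab : a ≠ b := by rintro rfl; exact ha1.2 hb1.1
    have hS1 : ∀ z, z ∈ S ↔ (z ∈ T ∧ z ≠ a) ∨ z = b := by
      intro z
      constructor
      · intro h
        by_cases hz : z ∈ T
        · left; exact ⟨hz, by rintro rfl; exact ha1.2 h⟩
        · right; exact hb2 z h hz
      · rintro (⟨h, h'⟩ | rfl)
        · by_contra hc; exact h' (ha2 z h hc)
        · exact hb1.1
    have hS2 : ∀ z, z ∉ S ↔ (z ∉ T ∧ z ≠ b) ∨ z = a := by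
      intro z
      rw [hS1]
      by_cases h1 : z = a
      · subst h1; tauto
      · by_cases h2 : z = b
        · subst h2; tauto
        · tauto
    obtain ⟨c1, hc1, hc1a⟩ := Finset.exists_mem_ne (by omega : 1 < T.card) a
    obtain ⟨c2, hc2, hc2b⟩ := Finset.exists_mem_ne
      (by rw [Finset.card_compl]; omega : 1 < Tᶜ.card) b
    rw [Finset.mem_compl] at hc2
    have hred : ∑ p ∈ NCs Y, eps (σ * p.2⁻¹) S =
        ∑ p ∈ (NCs Y).filter (fun p => ∀ t, σ t ∈ S ↔ p.2 t ∈ S), eps (σ * p.2⁻¹) S := by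
      rw [Finset.sum_filter]
      refine Finset.sum_congr rfl fun p _ => ?_
      split_ifs with h
      · rfl
      · exact eps_zero _ _ (by rwa [good_iff])
    rw [hred]
    have st1 : ∀ p ∈ (NCs Y).filter (fun p => ∀ t, σ t ∈ S ↔ p.2 t ∈ S), p.1 ∈ T → _ :=
      fun p hp hx => step (fun z => z ∈ T) p.2 p.1 a b c2 ha1.1 hb1.2 (by
        intro t
        rw [← hS1, ← hT]
        exact (Finset.mem_filter.1 hp).2 t) (Finset.mem_filter.1 (Finset.mem_filter.1 hp).1).2 hx
        hc2 hc2b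
    have st2 : ∀ p ∈ (NCs Y).filter (fun p => ∀ t, σ t ∈ S ↔ p.2 t ∈ S), p.1 ∉ T → _ :=
      fun p hp hx => step (fun z => z ∉ T) p.2 p.1 b a c1 hb1.2 (not_not.2 ha1.1) (by
        intro t
        rw [← hS2, ← hT]
        exact not_congr ((Finset.mem_filter.1 hp).2 t))
        (Finset.mem_filter.1 (Finset.mem_filter.1 hp).1).2 hx
        (not_not.2 hc1) hc1a
    have key : ∀ p ∈ (NCs Y).filter (fun p => ∀ t, σ t ∈ S ↔ p.2 t ∈ S),
      eps (σ * p.2⁻¹) S + eps (σ * (if p.1 ∈ T then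
          (p.2⁻¹ a, swap (p.2⁻¹ a) a * (swap p.1 b * p.2)) else
          (p.2⁻¹ b, swap (p.2⁻¹ b) b * (swap p.1 a * p.2))).2⁻¹) S = 0 := by
      intro p hp
      split_ifs with hx
      · obtain ⟨h1, h2, h3, h4, h5, h6⟩ := st1 p hp hx
        rw [eps_flip (σ * p.2⁻¹) (σ * (swap (p.2⁻¹ a) a * (swap p.1 b * p.2))⁻¹) S p.1 b (by rintro e; exact hb1.2 (e ▸ hx))
          ((hS1 _).2 (Or.inl ⟨hx, h6⟩)) hb1.1]
        · ring
        · intro z hz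
          have : swap (p.2⁻¹ a) a z = z := by
            apply swap_apply_of_ne_of_ne
            · rintro rfl
              rw [hS1] at hz; tauto
            · rintro rfl; exact ha1.2 hz
          simp only [mul_inv_rev, Perm.mul_apply, swap_inv, this]
      · obtain ⟨h1, h2, h3, h4, h5, h6⟩ := st2 p hp hx
        rw [eps_flip (σ * p.2⁻¹) (σ * (swap (p.2⁻¹ b) b * (swap p.1 a * p.2))⁻¹) S (p.2⁻¹ b) b (by rintro e; rw [e] at h1; exact h1 hb1.2)
          ((hS1 _).2 (Or.inl ⟨not_not.1 h1, h2⟩)) hb1.1]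
        · ring
        · intro z hz
          have hz2 := swap_mem ((hS1 _).2 (Or.inl ⟨not_not.1 h1, h2⟩)) hb1.1 hz
          have : swap p.1 a (swap (p.2⁻¹ b) b z) = swap (p.2⁻¹ b) b z := by
            apply swap_apply_of_ne_of_ne
            · intro e
              rw [e, hS1] at hz2; tauto
            · intro e; rw [e] at hz2; exact ha1.2 hz2
          simp only [mul_inv_rev, Perm.mul_apply, swap_inv]
          rw [this]
    refine Finset.sum_involution (fun p _ => if p.1 ∈ T then
          (p.2⁻¹ a, swap (p.2⁻¹ a) a * (swap p.1 b * p.2)) else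
          (p.2⁻¹ b, swap (p.2⁻¹ b) b * (swap p.1 a * p.2))) key ?_ ?_ ?_
    · intro p hp hne he
      have := key p hp
      rw [he] at this
      omega
    · intro p hp
      split_ifs with hx
      · obtain ⟨h1, h2, h3, h4, h5, h6⟩ := st1 p hp hx
        rw [Finset.mem_filter]
        refine ⟨Finset.mem_filter.2 ⟨Finset.mem_univ _, h3⟩, fun t => ?_⟩
        rw [hT, hS1]; exact h4 t
      · obtain ⟨h1, h2, h3, h4, h5, h6⟩ := st2 p hp hx
        rw [Finset.mem_filter]
        refine ⟨Finset.mem_filter.2 ⟨Finset.mem_univ _, h3⟩, fun t => ?_⟩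
        rw [hT, ← not_iff_not, hS2]; exact h4 t
    · intro p hp
      by_cases hx : p.1 ∈ T
      · obtain ⟨h1, h2, h3, h4, h5, h6⟩ := st1 p hp hx
        simp only [hx, if_true, h1, if_false]
        rw [h5]
        ext1
        · rfl
        · simp [mul_assoc]
      · obtain ⟨h1, h2, h3, h4, h5, h6⟩ := st2 p hp hx
        simp only [hx, if_true, not_not.1 h1, if_false]
        rw [h5]
        ext1
        · rfl
        · simp [mul_assoc]
  · obtain ⟨a, ha, b, hb, hab⟩ := Finset.one_lt_card.1 hgt
    rw [Finset.mem_sdiff] at ha hb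
    have key : ∀ p : Y × Perm Y, eps (σ * p.2⁻¹) S +
        eps (σ * (swap a b * p.2 * (swap a b)⁻¹)⁻¹) S = 0 := by
      intro p
      have hfix : ∀ s ∈ S, swap a b s = s := fun s hs => swap_apply_of_ne_of_ne
        (by rintro rfl; exact ha.2 hs) (by rintro rfl; exact hb.2 hs)
      by_cases hg : ∀ t, σ t ∈ S ↔ p.2 t ∈ S
      · have h1 := (hg a).1 ((hT a).2 ha.1)
        have h2 := (hg b).1 ((hT b).2 hb.1)
        rw [eps_flip (σ * p.2⁻¹) (σ * (swap a b * p.2 * (swap a b)⁻¹)⁻¹) S (p.2 a) (p.2 b) (by simpa using hab) h1 h2]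
        · ring
        · intro s hs
          have e1 : swap (p.2 a) (p.2 b) = p.2 * swap a b * p.2⁻¹ := by
            rw [Equiv.mul_swap_eq_swap_mul]; simp
          simp [e1, hfix s hs, mul_inv_rev]
      · rw [eps_zero, eps_zero, add_zero]
        · rw [good_iff]
          intro h
          apply hg
          intro t
          by_cases ht : t ∈ T
          · have h4 : swap a b t ∈ T := swap_mem ha.1 hb.1 ht
            have h5 := (h (swap a b t)).1 ((hT _).2 h4)
            simp only [Perm.mul_apply, swap_inv, swap_apply_self] at h5
            have h6 := hfix _ h5
            rw [swap_apply_self] at h6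
            rw [← h6] at h5
            exact ⟨fun _ => h5, fun _ => (hT t).2 ht⟩
          · have h4 : swap a b t = t := swap_apply_of_ne_of_ne
              (by rintro rfl; exact ht ha.1) (by rintro rfl; exact ht hb.1)
            have h5 := h t
            simp only [Perm.mul_apply, swap_inv, h4] at h5
            rw [h5]
            constructor
            · intro h6
              have := hfix _ h6
              rw [swap_apply_self] at this
              rw [this]; exact h6
            · intro h6; rw [hfix _ h6]; exact h6
        · rwa [good_iff]
    refine Finset.sum_involution (fun p _ => (swap a b p.1, swap a b * p.2 * (swap a b)⁻¹))
      (fun p _ => key p) ?_ ?_ ?_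
    · intro p _ hne he
      have := key p
      have h9 := (Prod.ext_iff.1 he).2
      simp only at h9
      rw [h9] at this
      omega
    · intro p hp
      simp only [NCs, Finset.mem_filter, Finset.mem_univ, true_and] at *
      rwa [nc_conj]
    · intro p _
      ext1
      · simp
      · simp [mul_assoc]

def ncD (x : Y) : ℕ := (univ.filter fun b : Perm Y => NC b x).card

lemma ncD_const (x y : Y) : ncD x = ncD y := by
  refine Finset.card_nbij' (fun b => swap x y * b * (swap x y)⁻¹)
    (fun b => swap x y * b * (swap x y)⁻¹) ?_ ?_ ?_ ?_
  · intro b hb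
    simp only [Finset.coe_filter, Finset.mem_univ, true_and, Set.mem_ofPred_eq] at *
    have := (nc_conj (swap x y) b x).2 hb
    rwa [swap_apply_left] at this
  · intro b hb
    simp only [Finset.coe_filter, Finset.mem_univ, true_and, Set.mem_ofPred_eq] at *
    have := (nc_conj (swap x y) b y).2 hb
    rwa [swap_apply_right] at this
  · intro b _; simp [mul_assoc]
  · intro b _; simp [mul_assoc]

lemma card_NCs (x : Y) : (NCs Y).card = Fintype.card Y * ncD x := by
  have : NCs Y = ((univ : Finset Y).sigma (fun y => univ.filter fun b : Perm Y => NC b y)).map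
      (Equiv.sigmaEquivProd Y (Perm Y)).toEmbedding := by
    ext ⟨y, b⟩
    simp [NCs]
  rw [this, Finset.card_map, Finset.card_sigma]
  have h2 : ∀ y ∈ (univ : Finset Y), (univ.filter fun b : Perm Y => NC b y).card = ncD x :=
    fun y _ => ncD_const y x
  rw [Finset.sum_congr rfl h2]
  simp

lemma nc_fix (h3 : 3 ≤ Fintype.card Y) {b : Perm Y} {x t : Y} (h : NC b x) (ht : b t = t) :
    x = t := by
  by_contra hne
  obtain ⟨u, hu⟩ : ∃ u, u ∉ ({x, t} : Finset Y) := by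
    by_contra! hc
    have := Finset.card_le_card (fun u _ => hc u : (univ : Finset Y) ⊆ {x, t})
    have h2 := Finset.card_le_two (a := x) (b := t)
    rw [Finset.card_univ] at this
    omega
  simp only [Finset.mem_insert, Finset.mem_singleton, not_or] at hu
  obtain ⟨i, hi⟩ := h.2 t u (Ne.symm hne) hu.1
  rw [Perm.zpow_apply_eq_self_of_apply_eq_self ht] at hi
  exact hu.2 hi.symm

lemma card_fix (h3 : 3 ≤ Fintype.card Y) (t : Y) :
    ((NCs Y).filter fun p => p.2 t = t).card = ncD t := by
  symm
  refine Finset.card_nbij' (fun b => (t, b)) (fun p => p.2) ?_ ?_ ?_ ?_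
  · intro b hb
    simp only [NCs, Finset.coe_filter, Finset.mem_filter, Finset.mem_univ, true_and,
      Set.mem_ofPred_eq] at *
    exact ⟨hb, hb.1⟩
  · intro p hp
    simp only [NCs, Finset.coe_filter, Finset.mem_filter, Finset.mem_univ, true_and,
      Set.mem_ofPred_eq] at *
    have := nc_fix h3 hp.1 hp.2
    exact this ▸ hp.1
  · intro b _; rfl
  · intro p hp
    simp only [NCs, Finset.coe_filter, Finset.mem_filter, Finset.mem_univ, true_and,
      Set.mem_ofPred_eq] at *
    have := nc_fix h3 hp.1 hp.2
    ext1
    · exact this.symm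
    · rfl

lemma card_move_le (t s u : Y) (hs : s ≠ t) (hu : u ≠ t) :
    ((NCs Y).filter fun p => p.2 t = s).card = ((NCs Y).filter fun p => p.2 t = u).card := by
  refine Finset.card_nbij' (fun p => (swap s u p.1, swap s u * p.2 * (swap s u)⁻¹))
    (fun p => (swap s u p.1, swap s u * p.2 * (swap s u)⁻¹)) ?_ ?_ ?_ ?_
  · intro p hp
    simp only [NCs, Finset.coe_filter, Finset.mem_filter, Finset.mem_univ, true_and,
      Set.mem_ofPred_eq] at *
    rw [nc_conj]
    refine ⟨hp.1, ?_⟩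
    rw [Perm.mul_apply, Perm.mul_apply, swap_inv, swap_apply_of_ne_of_ne hs.symm hu.symm, hp.2,
      swap_apply_left]
  · intro p hp
    simp only [NCs, Finset.coe_filter, Finset.mem_filter, Finset.mem_univ, true_and,
      Set.mem_ofPred_eq] at *
    rw [nc_conj]
    refine ⟨hp.1, ?_⟩
    rw [Perm.mul_apply, Perm.mul_apply, swap_inv, swap_apply_of_ne_of_ne hs.symm hu.symm, hp.2,
      swap_apply_right]
  · intro b _
    ext1 <;> simp [mul_assoc]
  · intro b _
    ext1 <;> simp [mul_assoc]

lemma card_at (h3 : 3 ≤ Fintype.card Y) (t s x : Y) :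
    ((NCs Y).filter fun p => p.2 t = s).card = ncD x := by
  rw [ncD_const x t]
  by_cases hst : s = t
  · subst hst; exact card_fix h3 s
  · have h1 : (NCs Y).card = ∑ u : Y, ((NCs Y).filter fun p => p.2 t = u).card :=
      Finset.card_eq_sum_card_fiberwise (fun _ _ => Finset.mem_coe.2 (Finset.mem_univ _))
    rw [card_NCs t, ← Finset.add_sum_erase _ _ (Finset.mem_univ t), card_fix h3,
      Finset.sum_congr rfl (fun u hu => card_move_le t u s (Finset.ne_of_mem_erase hu) hst)] at h1
    rw [Finset.sum_const, Finset.card_erase_of_mem (Finset.mem_univ _), Finset.card_univ,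
      smul_eq_mul] at h1
    obtain ⟨k, hk⟩ : ∃ k, Fintype.card Y = k + 1 := ⟨Fintype.card Y - 1, by omega⟩
    rw [hk, Nat.add_sub_cancel, add_mul, one_mul, add_comm] at h1
    have h4 := Nat.add_left_cancel h1
    exact (Nat.eq_of_mul_eq_mul_left (by omega) h4).symm

lemma sign_FC (h3 : 1 ≤ Fintype.card Y) {g : Perm Y} (h : FC g) :
    (-1 : ℤ) ^ Fintype.card Y * ((Perm.sign g : ℤˣ) : ℤ) = -1 := by
  obtain ⟨s⟩ : Nonempty Y := Fintype.card_pos_iff.1 h3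
  have := cyc_sign g s univ (fun t => by simp [h s t])
  have h2 : g.cycleOf s = g := by
    ext t; rw [(h s t).cycleOf_apply]
  rwa [h2, Finset.card_univ] at this

lemma sign_NC (h3 : 3 ≤ Fintype.card Y) {g : Perm Y} {x : Y} (h : NC g x) :
    (-1 : ℤ) ^ Fintype.card Y * ((Perm.sign g : ℤˣ) : ℤ) = 1 := by
  obtain ⟨s, -, hs⟩ := Finset.exists_mem_ne (by rw [Finset.card_univ]; omega :
    1 < (univ : Finset Y).card) x
  have hx : ∀ t, g.SameCycle s t ↔ t ≠ x := by
    intro t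
    constructor
    · rintro h1 rfl
      obtain ⟨i, hi⟩ := h1.symm
      rw [Perm.zpow_apply_eq_self_of_apply_eq_self h.1] at hi
      exact hs hi.symm
    · intro ht; exact h.2 s t hs ht
  have := cyc_sign g s (univ.erase x) (fun t => by rw [hx]; simp)
  have h2 : g.cycleOf s = g := by
    ext t
    by_cases ht : t = x
    · rw [Perm.cycleOf_apply_of_not_sameCycle (by rw [hx]; simpa using ht), ht, h.1]
    · rw [((hx t).2 ht).cycleOf_apply]
  rw [h2, Finset.card_erase_of_mem (Finset.mem_univ _), Finset.card_univ] at this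
  obtain ⟨k, hk⟩ : ∃ k, Fintype.card Y = k + 1 := ⟨Fintype.card Y - 1, by omega⟩
  rw [hk] at this ⊢
  rw [Nat.add_sub_cancel] at this
  rw [pow_succ]
  linear_combination -this

lemma eps_erase (g : Perm Y) (r : Y) : eps g (univ.erase r) =
    if g r = r then ((Perm.sign g : ℤˣ) : ℤ) else 0 := by
  split_ifs with h
  · refine eps_eq _ _ ?_ _ (fun _ _ => rfl) ?_
    · intro x hx
      simp only [Finset.mem_erase, Finset.mem_univ, and_true] at *
      intro e; exact hx (g.injective (e.trans h.symm))
    · intro x hx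
      simp at hx
      rw [hx, h]
  · apply eps_zero
    rw [← inv_iff]
    intro hc
    have := hc r
    simp [h] at this

lemma boccara (h3 : 3 ≤ Fintype.card Y) (σ : Perm Y) (hσ : Perm.sign σ = -1) (r : Y) :
    ((NCs Y).filter fun p => FC (σ * p.2⁻¹)).card = 2 * ncD r := by
  have e1 : (((NCs Y).filter fun p => FC (σ * p.2⁻¹)).card : ℤ) =
      ∑ S : Finset Y with r ∉ S, (-1 : ℤ) ^ S.card * ∑ p ∈ NCs Y, eps (σ * p.2⁻¹) S := by
    simp only [Finset.mul_sum]
    rw [Finset.sum_comm, Finset.card_filter]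
    push_cast
    exact Finset.sum_congr rfl fun p _ => (tree _ r).symm
  have e2 : ∀ S ∈ (univ : Finset (Finset Y)).filter (fun S => r ∉ S),
      (-1 : ℤ) ^ S.card * ∑ p ∈ NCs Y, eps (σ * p.2⁻¹) S =
      (if S = ∅ then (Fintype.card Y * ncD r : ℤ) else 0) + (if S.card = 1 then -(ncD r : ℤ) else 0)
      + (if S = univ.erase r then (ncD r : ℤ) else 0) := by
    intro S hS
    have hrS := (Finset.mem_filter.1 hS).2
    have hce : (univ.erase r : Finset Y).card = Fintype.card Y - 1 := by
      rw [Finset.card_erase_of_mem (Finset.mem_univ _), Finset.card_univ]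
    have hsub : S ⊆ univ.erase r := fun x hx => by
      simp; rintro rfl; exact hrS hx
    have hle := Finset.card_le_card hsub
    by_cases c0 : S = ∅
    · have : (∅ : Finset Y) ≠ univ.erase r := by
        intro e; rw [← e] at hce; simp at hce; omega
      subst c0
      simp [this, eps_empty, card_NCs r]
    by_cases c1 : S.card = 1
    · obtain ⟨s, rfl⟩ := Finset.card_eq_one.1 c1
      have : ({s} : Finset Y) ≠ univ.erase r := by
        intro e; rw [← e] at hce; simp at hce; omega
      simp only [this, c0, c1, if_true, if_false, eps_singleton]
      rw [Finset.sum_boole]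
      rw [← card_at h3 (σ⁻¹ s) s r]
      have : ∀ p : Y × Perm Y, (σ * p.2⁻¹) s = s ↔ p.2 (σ⁻¹ s) = s := by
        intro p
        rw [Perm.mul_apply, ← Perm.eq_inv_iff_eq, Perm.inv_eq_iff_eq, eq_comm]
      simp only [this]
      simp
    by_cases c2 : S = univ.erase r
    · simp only [c0, c1, if_false, c2, if_true]
      have n1 : (univ.erase r : Finset Y).card ≠ 1 := c2 ▸ c1
      have n2 : (univ.erase r : Finset Y) ≠ ∅ := c2 ▸ c0
      simp only [n1, n2, if_false]
      simp only [eps_erase, hce]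
      rw [Finset.mul_sum]
      have : ∀ p ∈ NCs Y, (-1 : ℤ) ^ (Fintype.card Y - 1) *
          (if (σ * p.2⁻¹) r = r then ((Perm.sign (σ * p.2⁻¹) : ℤˣ) : ℤ) else 0) =
          if p.2 (σ⁻¹ r) = r then 1 else 0 := by
        intro p hp
        have hi : (σ * p.2⁻¹) r = r ↔ p.2 (σ⁻¹ r) = r := by
          rw [Perm.mul_apply, ← Perm.eq_inv_iff_eq, Perm.inv_eq_iff_eq, eq_comm]
        simp only [hi]
        split_ifs
        · have hsg := sign_NC h3 (Finset.mem_filter.1 hp).2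
          rw [Perm.sign_mul, Perm.sign_inv, hσ]
          obtain ⟨k, hk⟩ : ∃ k, Fintype.card Y = k + 1 := ⟨Fintype.card Y - 1, by omega⟩
          rw [hk, pow_succ] at hsg
          rw [hk, Nat.add_sub_cancel]
          push_cast
          linear_combination hsg
        · simp
      rw [Finset.sum_congr rfl this, Finset.sum_boole, card_at h3 (σ⁻¹ r) r r]
      simp
    · have : S.card ≠ Fintype.card Y - 1 := by
        intro e
        exact c2 (Finset.eq_of_subset_of_card_le hsub (by rw [hce, e]))
      have c0' : S.card ≠ 0 := by simpa using c0
      rw [vanish σ S (by omega) (by omega)]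
      simp [c0, c1, c2]
  rw [Finset.sum_congr rfl e2, Finset.sum_add_distrib, Finset.sum_add_distrib,
    Finset.sum_ite_eq', Finset.sum_ite_eq', ← Finset.sum_filter, Finset.filter_filter] at e1
  have e3 : (univ.filter fun S : Finset Y => r ∉ S ∧ S.card = 1) =
      Finset.powersetCard 1 (univ.erase r) := by
    ext S
    rw [Finset.mem_powersetCard, Finset.mem_filter]
    refine ⟨fun h => ⟨fun x hx => ?_, h.2.2⟩, fun h => ⟨Finset.mem_univ _, fun hr => ?_, h.2⟩⟩
    · simp; rintro rfl; exact h.2.1 hx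
    · have := h.1 hr
      simp at this
  rw [e3, Finset.sum_const, Finset.card_powersetCard, Finset.card_erase_of_mem (Finset.mem_univ _),
    Finset.card_univ, Nat.choose_one_right] at e1
  obtain ⟨k, hk⟩ : ∃ k, Fintype.card Y = k + 1 := ⟨Fintype.card Y - 1, by omega⟩
  simp [hk] at e1
  zify
  rw [e1]; ring

def sepF (M B : Finset Y) : Finset (Perm Y) :=
  univ.filter fun σ => (∀ y, y ∉ M ∪ B → σ y = y) ∧ SepM M σ

lemma sep_sum (M : Finset Y) (w : Perm Y → ℤ) (ε : ℤ) (w1 : w 1 = 1)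
    (ws : ∀ x j d, x ≠ j → w (swap x j * d) = ε * w d) (B : Finset Y) :
    Disjoint B M → ∑ σ ∈ sepF M B, w σ = ∏ i ∈ range B.card, (1 + ε * (M.card + i)) := by
  induction B using Finset.induction_on with
  | empty =>
    intro _
    have : sepF M ∅ = {1} := by
      ext σ
      simp only [sepF, Finset.mem_filter, Finset.mem_univ, true_and, Finset.union_empty,
        Finset.mem_singleton]
      constructor
      · rintro ⟨h1, h2⟩
        ext y
        rw [Perm.one_apply]
        by_contra hy
        have hyM : y ∈ M := by by_contra hc; exact hy (h1 y hc)
        have hyM2 : σ y ∈ M := by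
          by_contra hc
          exact hy (σ.injective (h1 _ hc))
        exact h2 y hyM _ hyM2 (Ne.symm hy) ⟨1, by simp⟩
      · rintro rfl
        refine ⟨by simp, fun i _ j _ hij => ?_⟩
        simpa using hij
    rw [this]; simp [w1]
  | insert x B hxB ih =>
    intro hd
    rw [Finset.disjoint_insert_left] at hd
    have hx : x ∉ M ∪ B := by simp [hd.1, hxB]
    have key : ∑ σ ∈ sepF M (insert x B), w σ =
        ∑ p ∈ (insert x (M ∪ B)) ×ˢ sepF M B, w (swap x p.1 * p.2) := by
      symm
      refine Finset.sum_nbij' (fun p => swap x p.1 * p.2) (fun σ => (σ x, swap x (σ x) * σ))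
        ?_ ?_ ?_ ?_ ?_
      · rintro ⟨j, d⟩ hp
        simp only [Finset.mem_product, sepF, Finset.mem_filter, Finset.mem_univ, true_and] at *
        obtain ⟨hj, hd1, hd2⟩ := hp
        have hgx : (swap x j * d) x = j := by simp [hd1 x hx]
        refine ⟨fun y hy => ?_, fun i hi k hk hik => ?_⟩
        · rw [Finset.union_insert, Finset.mem_insert, not_or] at hy
          rw [Perm.mul_apply, hd1 y hy.2, swap_apply_of_ne_of_ne hy.1]
          rintro rfl
          rw [Finset.mem_insert] at hj
          tauto
        · rw [← removal (swap x j * d) d x (by rw [hgx]; simp [← mul_assoc])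
            (by rintro rfl; exact hd.1 hi) (by rintro rfl; exact hd.1 hk)]
          exact hd2 i hi k hk hik
      · intro σ hσ
        simp only [Finset.mem_product, sepF, Finset.mem_filter, Finset.mem_univ, true_and,
          Finset.union_insert] at *
        obtain ⟨h1, h2⟩ := hσ
        refine ⟨?_, fun y hy => ?_, fun i hi k hk hik => ?_⟩
        · by_contra hc
          have := σ.injective (h1 _ hc)
          rw [this] at hc
          exact hc (Finset.mem_insert_self _ _)
        · by_cases hyx : y = x
          · subst hyx; simp
          · have h3 := h1 y (by rw [Finset.mem_insert, not_or]; exact ⟨hyx, hy⟩)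
            rw [Perm.mul_apply, h3, swap_apply_of_ne_of_ne hyx]
            intro e
            exact hyx (σ.injective (h3.trans e))
        · rw [removal σ _ x rfl (by rintro rfl; exact hd.1 hi) (by rintro rfl; exact hd.1 hk)]
          exact h2 i hi k hk hik
      · rintro ⟨j, d⟩ hp
        simp only [Finset.mem_product, sepF, Finset.mem_filter, Finset.mem_univ, true_and] at *
        have hgx : (swap x j * d) x = j := by simp [hp.2.1 x hx]
        rw [hgx]; simp [← mul_assoc]
      · intro σ _
        simp [← mul_assoc]
      · intro p _; rfl
    rw [key, Finset.sum_product, Finset.sum_insert hx]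
    have h1 : ∀ d, w (swap x x * d) = w d := by intro d; congr 1; ext y; simp
    have h2 : ∀ j ∈ M ∪ B, ∑ d ∈ sepF M B, w (swap x j * d) = ε * ∑ d ∈ sepF M B, w d := by
      intro j hj
      rw [Finset.mul_sum]
      exact Finset.sum_congr rfl fun d _ => ws x j d (by rintro rfl; exact hx hj)
    rw [Finset.sum_congr rfl h2, Finset.sum_congr rfl (fun d _ => h1 d), ih hd.2, Finset.sum_const,
      Finset.card_union_of_disjoint hd.2.symm, Finset.card_insert_of_notMem hxB,
      Finset.prod_range_succ]
    simp only [nsmul_eq_mul]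
    push_cast
    ring

lemma sepF_univ (M : Finset Y) : sepF M (univ \ M) = univ.filter fun σ => SepM M σ := by
  ext σ
  simp [sepF]

lemma prod_plus (m b : ℕ) : (∏ i ∈ range b, (1 + 1 * ((m : ℤ) + i))) * m.factorial =
    (m + b).factorial := by
  induction b with
  | zero => simp
  | succ k ih =>
    rw [Finset.prod_range_succ, ← add_assoc, Nat.factorial_succ]
    push_cast
    rw [← ih]; ring

lemma prod_minus (m b : ℕ) : (∏ i ∈ range b, (1 + (-1) * (((m + 2 : ℕ) : ℤ) + i))) * m.factorial =
    (-1) ^ b * (m + b).factorial := by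
  induction b with
  | zero => simp
  | succ k ih =>
    rw [Finset.prod_range_succ, ← add_assoc, Nat.factorial_succ, pow_succ]
    push_cast at *
    linear_combination (-(m + k + 1 : ℤ)) * ih

def oddSep (M : Finset Y) : ℕ := (univ.filter fun σ : Perm Y => Perm.sign σ = -1 ∧ SepM M σ).card

lemma odd_count (M : Finset Y) (m b : ℕ) (hM : M.card = m + 2) (hb : Fintype.card Y = m + 2 + b) :
    (2 : ℚ) * oddSep M = ((m + 2 + b).factorial : ℚ) / (m + 2).factorial
      - (-1) ^ b * (m + b).factorial / m.factorial := by
  have hB : (univ \ M).card = b := by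
    rw [Finset.card_sdiff_of_subset (Finset.subset_univ _), Finset.card_univ]; omega
  have h1 := sep_sum M (fun _ => 1) 1 rfl (by intros; rfl) (univ \ M) Finset.sdiff_disjoint
  have h2 := sep_sum M (fun σ => ((Perm.sign σ : ℤˣ) : ℤ)) (-1) (by simp)
    (by intro x j d h; simp [Perm.sign_swap h]) (univ \ M) Finset.sdiff_disjoint
  rw [sepF_univ, hB, hM] at h1 h2
  have h3 := prod_plus (m + 2) b
  have h4 := prod_minus m b
  rw [← h1] at h3
  rw [← h2] at h4
  have h5 : (2 : ℤ) * oddSep M = ∑ σ : Perm Y with SepM M σ, 1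
      - ∑ σ : Perm Y with SepM M σ, ((Perm.sign σ : ℤˣ) : ℤ) := by
    rw [← Finset.sum_sub_distrib, oddSep, ← Finset.sum_boole, Finset.mul_sum]
    simp only [Finset.sum_filter]
    refine Finset.sum_congr rfl fun σ _ => ?_
    rcases Int.units_eq_one_or (Perm.sign σ) with h | h <;> by_cases h' : SepM M σ <;> simp [h, h']
  have h5' : (2 : ℚ) * oddSep M = ((∑ σ : Perm Y with SepM M σ, 1 : ℤ) : ℚ)
      - ((∑ σ : Perm Y with SepM M σ, ((Perm.sign σ : ℤˣ) : ℤ) : ℤ) : ℚ) := by exact_mod_cast h5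
  have h3' : ((∑ σ : Perm Y with SepM M σ, 1 : ℤ) : ℚ) * (m + 2).factorial =
    (m + 2 + b).factorial := by exact_mod_cast h3
  have h4' : ((∑ σ : Perm Y with SepM M σ, ((Perm.sign σ : ℤˣ) : ℤ) : ℤ) : ℚ) * m.factorial =
    (-1) ^ b * (m + b).factorial := by exact_mod_cast h4
  rw [h5', ← h3', ← h4']
  have f1 : ((m + 2).factorial : ℚ) ≠ 0 := by exact_mod_cast Nat.factorial_ne_zero _
  have f2 : (m.factorial : ℚ) ≠ 0 := by exact_mod_cast Nat.factorial_ne_zero _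
  rw [mul_div_cancel_right₀ _ f1, mul_div_cancel_right₀ _ f2]

def Lx (x : Y) (M : Finset Y) : ℕ := (univ.filter fun p : Perm Y × Perm Y =>
  NC p.2 x ∧ FC (p.1 * p.2⁻¹) ∧ SepM M p.1).card

lemma Lx_conj (t : Perm Y) (x : Y) (M : Finset Y) : Lx x M = Lx (t x) (M.image t) := by
  have e : ∀ a b : Perm Y, t * a * t⁻¹ * (t * b * t⁻¹)⁻¹ = t * (a * b⁻¹) * t⁻¹ := by
    intro a b; group
  refine Finset.card_nbij' (fun p => (t * p.1 * t⁻¹, t * p.2 * t⁻¹))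
    (fun p => (t⁻¹ * p.1 * t, t⁻¹ * p.2 * t)) ?_ ?_ ?_ ?_
  · intro p hp
    simp only [Finset.coe_filter, Finset.mem_univ, true_and, Set.mem_ofPred_eq] at *
    rw [e, nc_conj, fc_conj, sep_conj]; exact hp
  · intro p hp
    simp only [Finset.coe_filter, Finset.mem_univ, true_and, Set.mem_ofPred_eq] at *
    rw [← nc_conj t, ← fc_conj t, ← sep_conj t, ← e]
    simpa [mul_assoc] using hp
  · intro p _; simp [mul_assoc]
  · intro p _; simp [mul_assoc]

lemma total (h3 : 3 ≤ Fintype.card Y) (r : Y) (M : Finset Y) :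
    ∑ x, Lx x M = 2 * ncD r * oddSep M := by
  have h1 : ∀ σ : Perm Y, ∑ p ∈ NCs Y, (if FC (σ * p.2⁻¹) then 1 else 0) =
      if Perm.sign σ = -1 then 2 * ncD r else 0 := by
    intro σ
    split_ifs with h
    · rw [← boccara h3 σ h r, Finset.card_filter]
    · refine Finset.sum_eq_zero fun p hp => if_neg fun hF => h ?_
      have s1 := sign_FC (by omega) hF
      have s2 := sign_NC h3 (Finset.mem_filter.1 hp).2
      rw [Perm.sign_mul, Perm.sign_inv] at s1
      push_cast at s1
      have s3 : ((Perm.sign σ : ℤˣ) : ℤ) = -1 := by linear_combination s1 - (Perm.sign σ : ℤ) * s2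
      exact Units.ext (by simpa using s3)
  have h2 : ∑ x, Lx x M = ∑ σ : Perm Y, if SepM M σ then
      ∑ p ∈ NCs Y, (if FC (σ * p.2⁻¹) then 1 else 0) else 0 := by
    simp only [Lx, Finset.card_filter, Fintype.sum_prod_type, NCs, Finset.sum_filter]
    rw [Finset.sum_comm]
    refine Finset.sum_congr rfl fun σ _ => ?_
    split_ifs with h
    · refine Finset.sum_congr rfl fun x _ => Finset.sum_congr rfl fun b _ => ?_
      by_cases q1 : NC b x <;> by_cases q2 : FC (σ * b⁻¹) <;> simp [q1, q2, h]
    · simp [h]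
  rw [h2, oddSep, Finset.card_filter, Finset.mul_sum]
  refine Finset.sum_congr rfl fun σ _ => ?_
  rw [h1]
  by_cases q1 : SepM M σ <;> by_cases q2 : Perm.sign σ = -1 <;> simp [q1, q2]

lemma oc_same {n : ℕ} (u : Perm (Fin n)) (a b : Fin n) :
    Perm.SameCycle (optionCongr u : Perm (Option (Fin n))) (some a) (some b) ↔ u.SameCycle a b := by
  constructor
  · intro h
    have := sameCycle_lift (optionCongr u : Perm (Option (Fin n))) u (fun o => o.getD a) (by
      rintro (_ | s)
      · exact Perm.SameCycle.refl _ _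
      · exact ⟨1, by simp⟩) h
    simpa using this
  · intro h
    refine sameCycle_lift u (optionCongr u : Perm (Option (Fin n))) some ?_ h
    intro s
    exact ⟨1, by simp⟩

lemma oc_nc {n : ℕ} (u : Perm (Fin n)) :
    NC (optionCongr u : Perm (Option (Fin n))) none ↔ FC u := by
  constructor
  · intro h s t
    exact (oc_same u s t).1 (h.2 (some s) (some t) (by simp) (by simp))
  · intro h
    refine ⟨by simp, ?_⟩
    rintro (_ | s) (_ | t) hs ht
    · exact absurd rfl hs
    · exact absurd rfl hs
    · exact absurd rfl ht
    · exact (oc_same u s t).2 (h s t)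

lemma oc_mul {n : ℕ} (u v : Perm (Fin n)) :
    (optionCongr (u * v) : Perm (Option (Fin n))) = optionCongr u * optionCongr v := by
  ext1 x
  cases x <;> simp

lemma oc_exists {n : ℕ} (b : Perm (Option (Fin n))) (h : b none = none) :
    ∃ v : Perm (Fin n), b = optionCongr v := by
  have := Perm.decomposeOption_symm_apply (Perm.decomposeOption b)
  rw [Equiv.symm_apply_apply] at this
  refine ⟨(Perm.decomposeOption b).2, ?_⟩
  have h2 : (Perm.decomposeOption b).1 = none := by
    simp [h]
  rw [h2] at this
  rw [this, swap_self]
  rfl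

def ins {n : ℕ} (j : Fin n) (w : Perm (Fin n)) : Perm (Option (Fin n)) :=
  swap none (some j) * optionCongr w

lemma ins_none {n : ℕ} (j : Fin n) (w : Perm (Fin n)) : ins j w none = some j := by
  simp [ins]

lemma ins_same {n : ℕ} (j : Fin n) (w : Perm (Fin n)) (a b : Fin n) :
    (ins j w).SameCycle (some a) (some b) ↔ w.SameCycle a b := by
  rw [← oc_same w]
  exact (removal (ins j w) (optionCongr w) none (by rw [ins_none]; simp [ins, ← mul_assoc])
    (Option.some_ne_none a) (Option.some_ne_none b)).symm

lemma ins_same_none {n : ℕ} (j : Fin n) (w : Perm (Fin n)) (b : Fin n) :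
    (ins j w).SameCycle none (some b) ↔ w.SameCycle j b := by
  rw [← ins_same j w, ← ins_none j w]
  simp

lemma sep_ins_notMem {n : ℕ} (j : Fin n) (w : Perm (Fin n)) (M : Finset (Option (Fin n)))
    (h : none ∉ M) : SepM M (ins j w) ↔ SepM (eraseNone M) w := by
  constructor
  · intro H a ha b hb hab hs
    rw [mem_eraseNone] at ha hb
    exact H _ ha _ hb (by simpa using hab) ((ins_same j w a b).2 hs)
  · rintro H (_ | a) ha (_ | b) hb hab hs
    · exact hab rfl
    · exact h ha
    · exact h hb
    · exact H a (mem_eraseNone.2 ha) b (mem_eraseNone.2 hb) (by simpa using hab)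
        ((ins_same j w a b).1 hs)

lemma sep_ins_mem {n : ℕ} (j : Fin n) (w : Perm (Fin n)) (M : Finset (Option (Fin n)))
    (h : none ∈ M) : SepM M (ins j w) ↔ j ∉ eraseNone M ∧ SepM (insert j (eraseNone M)) w := by
  constructor
  · intro H
    have h1 : ∀ b ∈ eraseNone M, ¬ w.SameCycle j b := fun b hb hs =>
      H none h (some b) (mem_eraseNone.1 hb) (by simp) ((ins_same_none j w b).2 hs)
    refine ⟨fun hj => h1 j hj (Perm.SameCycle.refl _ _), ?_⟩
    intro a ha b hb hab hs
    rw [Finset.mem_insert] at ha hb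
    rcases ha with rfl | ha
    · rcases hb with rfl | hb
      · exact hab rfl
      · exact h1 b hb hs
    · rcases hb with rfl | hb
      · exact h1 a ha hs.symm
      · exact H _ (mem_eraseNone.1 ha) _ (mem_eraseNone.1 hb) (by simpa using hab)
          ((ins_same j w a b).2 hs)
  · rintro ⟨hj, H⟩ (_ | a) ha (_ | b) hb hab hs
    · exact hab rfl
    · have hb := mem_eraseNone.2 hb
      exact H j (Finset.mem_insert_self _ _) b (Finset.mem_insert_of_mem hb)
        (by rintro rfl; exact hj hb) ((ins_same_none j w b).1 hs)
    · have ha := mem_eraseNone.2 ha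
      exact H j (Finset.mem_insert_self _ _) a (Finset.mem_insert_of_mem ha)
        (by rintro rfl; exact hj ha) ((ins_same_none j w a).1 hs.symm)
    · exact H a (Finset.mem_insert_of_mem (mem_eraseNone.2 ha)) b
        (Finset.mem_insert_of_mem (mem_eraseNone.2 hb)) (by simpa using hab)
        ((ins_same j w a b).1 hs)

def cc {n : ℕ} (M : Finset (Fin n)) : ℕ :=
  (univ.filter fun q : Perm (Fin n) × Perm (Fin n) => FC q.1 ∧ FC q.2 ∧ SepM M (q.1 * q.2)).card

lemma cc_le {n : ℕ} (t : Perm (Fin n)) (M : Finset (Fin n)) : cc M ≤ cc (M.image t) := by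
  refine Finset.card_le_card_of_injOn (fun q => (t * q.1 * t⁻¹, t * q.2 * t⁻¹)) ?_ ?_
  · rintro ⟨u, v⟩ hq
    simp only [Finset.coe_filter, Finset.mem_univ, true_and, Set.mem_ofPred_eq] at *
    refine ⟨(fc_conj t u).2 hq.1, (fc_conj t v).2 hq.2.1, ?_⟩
    have := (sep_conj t (u * v) M).2 hq.2.2
    simpa [mul_assoc] using this
  · rintro ⟨u, v⟩ _ ⟨u', v'⟩ _ h
    simpa using h

lemma cc_le_of_card {n : ℕ} (M M' : Finset (Fin n)) (h : M.card = M'.card) : cc M ≤ cc M' := by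
  let t : Perm (Fin n) := (Finset.equivOfCardEq h).extendSubtype
  have : M.image t = M' := by
    apply Finset.eq_of_subset_of_card_le
    · intro x hx
      rw [Finset.mem_image] at hx
      obtain ⟨y, hy, rfl⟩ := hx
      exact Equiv.extendSubtype_mem (Finset.equivOfCardEq h) y hy
    · rw [Finset.card_image_of_injective _ t.injective, h]
  rw [← this]
  exact cc_le t M

lemma cc_eq {n : ℕ} (M M' : Finset (Fin n)) (h : M.card = M'.card) : cc M = cc M' :=
  le_antisymm (cc_le_of_card M M' h) (cc_le_of_card M' M h.symm)

lemma Lx_none {n : ℕ} (hn : 2 ≤ n) (M : Finset (Option (Fin n))) :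
    Lx none M = ∑ j : Fin n, (univ.filter fun q : Perm (Fin n) × Perm (Fin n) =>
      FC q.1 ∧ FC q.2 ∧ SepM M (ins j (q.1 * q.2))).card := by
  have h1 : (univ.filter fun t : Fin n × (Perm (Fin n) × Perm (Fin n)) =>
      FC t.2.1 ∧ FC t.2.2 ∧ SepM M (ins t.1 (t.2.1 * t.2.2))).card = Lx none M := by
    refine Finset.card_nbij (fun t => (ins t.1 (t.2.1 * t.2.2), optionCongr t.2.2)) ?_ ?_ ?_
    · rintro ⟨j, u, v⟩ h
      simp only [Finset.coe_filter, Finset.mem_filter, Finset.mem_univ, true_and,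
        Set.mem_ofPred_eq] at *
      refine ⟨(oc_nc v).2 h.2.1, ?_, h.2.2⟩
      have : ins j (u * v) * (optionCongr v : Perm (Option (Fin n)))⁻¹
          = swap none (some j) * optionCongr u := by
        rw [ins, oc_mul]; group
      rw [this]
      exact fc_insert _ _ _ (by simp) ((oc_nc u).2 h.1)
    · rintro ⟨j, u, v⟩ _ ⟨j', u', v'⟩ _ h
      simp only [Prod.mk.injEq] at h
      have hv : v = v' := optionCongr_injective h.2
      have hj : j = j' := by
        have := congrArg (fun g => g none) h.1
        simpa [ins_none] using this
      subst hv hj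
      have := optionCongr_injective (mul_left_cancel h.1)
      have := mul_right_cancel this
      rw [this]
    · rintro ⟨s, b⟩ h
      simp only [Finset.coe_filter, Finset.mem_univ, true_and, Set.mem_ofPred_eq] at h
      obtain ⟨hb, ha, hs⟩ := h
      obtain ⟨v, rfl⟩ := oc_exists b hb.1
      set α := s * (optionCongr v : Perm (Option (Fin n)))⁻¹ with hα
      have hne : α none ≠ none := by
        intro e
        obtain ⟨i, hi⟩ := ha none (some ⟨0, by omega⟩)
        rw [Perm.zpow_apply_eq_self_of_apply_eq_self e] at hi
        cases hi
      obtain ⟨j, hj⟩ := Option.ne_none_iff_exists'.1 hne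
      have hr := nc_remove α none hne ha
      obtain ⟨u, hu⟩ := oc_exists _ hr.1
      rw [hu] at hr
      have hs' : s = ins j (u * v) := by
        rw [ins, oc_mul, ← hu, hj, hα]
        simp [← mul_assoc]
      refine ⟨(j, u, v), ?_, ?_⟩
      · simp only [Finset.coe_filter, Finset.mem_univ, true_and, Set.mem_ofPred_eq]
        refine ⟨(oc_nc u).1 hr, (oc_nc v).1 hb, ?_⟩
        rw [← hs']; exact hs
      · simp [hs']
  rw [← h1, Finset.card_filter, Fintype.sum_prod_type]
  simp_rw [← Finset.card_filter]

lemma Lx_none_notMem {n : ℕ} (hn : 2 ≤ n) (M : Finset (Option (Fin n))) (h : none ∉ M)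
    (M₀ : Finset (Fin n)) (h0 : M.card = M₀.card) : Lx none M = n * cc M₀ := by
  rw [Lx_none hn]
  have : ∀ j ∈ (univ : Finset (Fin n)), (univ.filter fun q : Perm (Fin n) × Perm (Fin n) =>
      FC q.1 ∧ FC q.2 ∧ SepM M (ins j (q.1 * q.2))).card = cc M₀ := by
    intro j _
    rw [← cc_eq (eraseNone M) M₀ (by rw [card_eraseNone_of_not_mem h, h0])]
    simp_rw [sep_ins_notMem _ _ M h]
    rfl
  rw [Finset.sum_congr rfl this]
  simp

lemma Lx_none_mem {n : ℕ} (hn : 2 ≤ n) (M : Finset (Option (Fin n))) (h : none ∈ M)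
    (M₀ : Finset (Fin n)) (h0 : M.card = M₀.card) : Lx none M = (n + 1 - M₀.card) * cc M₀ := by
  rw [Lx_none hn]
  have hc : (eraseNone M).card = M.card - 1 := card_eraseNone_of_mem h
  have hpos : 0 < M.card := Finset.card_pos.2 ⟨_, h⟩
  have : ∀ j ∈ (univ : Finset (Fin n)), (univ.filter fun q : Perm (Fin n) × Perm (Fin n) =>
      FC q.1 ∧ FC q.2 ∧ SepM M (ins j (q.1 * q.2))).card =
      if j ∈ (eraseNone M)ᶜ then cc M₀ else 0 := by
    intro j _
    simp_rw [sep_ins_mem _ _ M h, Finset.mem_compl]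
    by_cases hj : j ∉ eraseNone M
    on_goal 1 => rw [if_pos hj]
    · rw [← cc_eq (insert j (eraseNone M)) M₀ (by rw [Finset.card_insert_of_notMem hj]; omega)]
      simp only [hj, not_false_eq_true, true_and]
      rfl
    · rw [if_neg hj]; simp only [hj, false_and, and_false, Finset.filter_false, Finset.card_empty]
  rw [Finset.sum_congr rfl this, Finset.sum_ite_mem, Finset.univ_inter, Finset.sum_const,
    Finset.card_compl, hc, Fintype.card_fin, smul_eq_mul]
  congr 1
  omega

lemma sum_Lx {n : ℕ} (hn : 2 ≤ n) (M₀ : Finset (Fin n)) :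
    ∑ x, Lx x (M₀.map Function.Embedding.some) = (n + 1 - M₀.card) * (n + M₀.card) * cc M₀ := by
  set M := M₀.map Function.Embedding.some with hM
  have hcard : M.card = M₀.card := Finset.card_map _
  have : ∀ x ∈ (univ : Finset (Option (Fin n))), Lx x M =
      if x ∈ M then (n + 1 - M₀.card) * cc M₀ else n * cc M₀ := by
    intro x _
    rw [Lx_conj (swap none x) x M, swap_apply_right]
    have hc : (M.image (swap none x)).card = M₀.card := by
      rw [Finset.card_image_of_injective _ (swap none x).injective, hcard]
    have hiff : none ∈ M.image (swap none x) ↔ x ∈ M := by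
      rw [Finset.mem_image]
      constructor
      · rintro ⟨y, hy, e⟩
        rw [Equiv.swap_apply_eq_iff, swap_apply_left] at e
        exact e ▸ hy
      · intro hx
        exact ⟨x, hx, by simp⟩
    split_ifs with hx
    · exact Lx_none_mem hn _ (hiff.2 hx) M₀ hc
    · exact Lx_none_notMem hn _ (fun e => hx (hiff.1 e)) M₀ hc
  rw [Finset.sum_congr rfl this, Finset.sum_ite, Finset.sum_const, Finset.sum_const]
  have e1 : (univ.filter fun x => x ∈ M) = M := by ext; simp
  have e2 : (univ.filter fun x => x ∉ M) = Mᶜ := by ext; simp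
  rw [e1, e2, Finset.card_compl, hcard, Fintype.card_option, Fintype.card_fin]
  simp only [smul_eq_mul]
  ring

lemma fc_iff_cycleType {n : ℕ} (hn : 2 ≤ n) (g : Perm (Fin n)) : FC g ↔ g.cycleType = {n} := by
  constructor
  · intro h
    have hmove : ∀ x, g x ≠ x := by
      intro x e
      obtain ⟨y, hy⟩ : ∃ y : Fin n, y ≠ x := by
        have : Nontrivial (Fin n) := Fin.nontrivial_iff_two_le.2 hn
        exact exists_ne x
      obtain ⟨i, hi⟩ := h x y
      rw [Perm.zpow_apply_eq_self_of_apply_eq_self e] at hi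
      exact hy hi.symm
    have hc : g.IsCycle := ⟨⟨0, by omega⟩, hmove _, fun y _ => h _ y⟩
    have hs : g.support = univ := by ext x; simp [hmove x]
    rw [hc.cycleType, hs]
    simp
  · intro h s t
    have hc : g.IsCycle := Perm.card_cycleType_eq_one.1 (by rw [h]; simp)
    have hs : g.support.card = n := by rw [← Perm.sum_cycleType, h]; simp
    have hs' : g.support = univ := by
      rw [← Finset.card_eq_iff_eq_univ, hs, Fintype.card_fin]
    have hm : ∀ x, g x ≠ x := fun x => Perm.mem_support.1 (hs' ▸ Finset.mem_univ x)
    exact hc.sameCycle (hm s) (hm t)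

lemma ncD_fin {n : ℕ} (hn : 2 ≤ n) : ncD (none : Option (Fin n)) = (n - 1).factorial := by
  have h1 : (univ.filter fun g : Perm (Fin n) => FC g).card = (n - 1).factorial := by
    simp_rw [fc_iff_cycleType hn]
    have := Perm.card_of_cycleType_singleton (α := Fin n) hn (by simp)
    simp only [Fintype.card_fin, Nat.choose_self, mul_one] at this
    rw [← this]
  rw [← h1]
  symm
  refine Finset.card_nbij (fun v => (optionCongr v : Perm (Option (Fin n)))) ?_ ?_ ?_
  · intro v hv
    simp only [Finset.coe_filter, Finset.mem_filter, Finset.mem_univ, true_and,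
      Set.mem_ofPred_eq] at *
    exact (oc_nc v).2 hv
  · intro v _ v' _ h
    exact optionCongr_injective h
  · intro b hb
    simp only [Finset.coe_filter, Finset.mem_univ, true_and, Set.mem_ofPred_eq] at hb
    obtain ⟨v, rfl⟩ := oc_exists b hb.1
    refine ⟨v, ?_, rfl⟩
    simp only [Finset.coe_filter, Finset.mem_univ, true_and, Set.mem_ofPred_eq]
    exact (oc_nc v).1 hb

lemma fullCycle_iff {n : ℕ} (hn : 2 ≤ n) (g : Perm (Fin n)) : IsFullCycle g ↔ FC g := by
  rw [fc_iff_cycleType hn, IsFullCycle, cycleCount]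
  constructor
  · intro h
    have hfix : (univ.filter fun x => g x = x).card + g.support.card = n := by
      have := Finset.card_filter_add_card_filter_not (s := (univ : Finset (Fin n)))
        (fun x => g x = x)
      simpa [Perm.support] using this
    rcases Nat.eq_zero_or_pos g.cycleType.card with h0 | h0
    · have h1 : g.support.card = 0 := by
        rw [← Perm.sum_cycleType, Multiset.card_eq_zero.1 h0]; simp
      omega
    · have hc : g.IsCycle := Perm.card_cycleType_eq_one.1 (by omega)
      rw [hc.cycleType]
      congr 1
      omega
  · intro h
    have hfc := (fc_iff_cycleType hn g).2 h
    have hs : g.support.card = n := by rw [← Perm.sum_cycleType, h]; simp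
    have hs' : g.support = univ := by
      rw [← Finset.card_eq_iff_eq_univ, hs, Fintype.card_fin]
    have hm : ∀ x, g x ≠ x := fun x => Perm.mem_support.1 (hs' ▸ Finset.mem_univ x)
    simp [h, hm]

lemma main_cc {n m : ℕ} (hn : 2 ≤ n) (hm2 : 2 ≤ m) (hm : m ≤ n)
    (heven : Even (n - m)) (M₀ : Finset (Fin n)) (h0 : M₀.card = m) :
    (cc M₀ : ℚ) = (Nat.factorial (n - 1) : ℚ) ^ 2 *
      (1 / (Nat.factorial m : ℚ) +
        2 / ((Nat.factorial (m - 2) : ℚ) * ((n + 1 - m : ℕ) : ℚ) * ((n + m : ℕ) : ℚ))) := by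
  have h1 := sum_Lx hn M₀
  rw [total (by rw [Fintype.card_option, Fintype.card_fin]; omega) none, ncD_fin hn, h0] at h1
  obtain ⟨k, rfl⟩ : ∃ k, m = k + 2 := ⟨m - 2, by omega⟩
  obtain ⟨e, he⟩ := heven
  obtain rfl : n = k + 2 + (e + e) := by omega
  have h2 := odd_count (M₀.map Function.Embedding.some) k (e + e + 1)
    (by rw [Finset.card_map, h0]) (by rw [Fintype.card_option, Fintype.card_fin]; omega)
  have hpow : (-1 : ℚ) ^ (e + e + 1) = -1 := Odd.neg_one_pow ⟨e, by ring⟩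
  rw [hpow] at h2
  have e1 : k + 2 + (e + e) - 1 = k + (e + e + 1) := by omega
  have e2 : k + 2 + (e + e) + 1 - (k + 2) = e + e + 1 := by omega
  have e3 : k + 2 - 2 = k := by omega
  rw [e1, e2] at h1
  rw [e1, e2]
  rw [e3]
  have f1 : ((k + 2 + (e + e + 1)).factorial : ℚ) =
      (k + 2 + (e + e + 1)) * (k + 1 + (e + e + 1)) * (k + (e + e + 1)).factorial := by
    have : k + 2 + (e + e + 1) = k + (e + e + 1) + 1 + 1 := by ring
    rw [this, Nat.factorial_succ, Nat.factorial_succ]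
    push_cast; ring
  have f2 : ((k + 2).factorial : ℚ) = (k + 2) * (k + 1) * k.factorial := by
    rw [Nat.factorial_succ, Nat.factorial_succ]; push_cast; ring
  rw [f1, f2] at h2
  rw [f2]
  have h1q : ((2 * (k + (e + e + 1)).factorial * oddSep (M₀.map Function.Embedding.some) : ℕ) : ℚ) =
    (((e + e + 1) * (k + 2 + (e + e) + (k + 2)) * cc M₀ : ℕ) : ℚ) := by exact_mod_cast h1
  push_cast at h1q ⊢
  have hk : (k.factorial : ℚ) ≠ 0 := by exact_mod_cast k.factorial_ne_zero
  set F : ℚ := ((k + (e + e + 1)).factorial : ℚ)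
  set O : ℚ := (oddSep (M₀.map Function.Embedding.some) : ℚ)
  set K : ℚ := (k.factorial : ℚ)
  have hA : ((e : ℚ) + e + 1) ≠ 0 := by positivity
  have hB : ((k : ℚ) + 2 + (e + e) + (k + 2)) ≠ 0 := by positivity
  have hC : (cc M₀ : ℚ) = F * (2 * O) / (((e : ℚ) + e + 1) * ((k : ℚ) + 2 + (e + e) + (k + 2))) := by
    field_simp
    linarith
  rw [hC, h2]
  have hk1 : (k : ℚ) + 1 ≠ 0 := by positivity
  have hk2 : (k : ℚ) + 2 ≠ 0 := by positivity
  field_simp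
  ring

end SepHelpers
/-- For `n ≥ 2` and `2 ≤ m ≤ n` with `n - m` even, the number of ordered
pairs `(u, v)` of `n`-cycles on `[n]` whose product `u ∘ v` separates `[m]` equals
`((n-1)!)² ⬝ (1/m! + 2/((m-2)! (n+1-m) (n+m)))`, as an identity of rational numbers. -/
theorem separation_probability_even (n m : ℕ) (hn : 2 ≤ n) (hm2 : 2 ≤ m) (hm : m ≤ n)
    (heven : Even (n - m)) :
    (Nat.card {p : Equiv.Perm (Fin n) × Equiv.Perm (Fin n) //
        IsFullCycle p.1 ∧ IsFullCycle p.2 ∧ Separates m (p.1 * p.2)} : ℚ) =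
    (Nat.factorial (n - 1) : ℚ) ^ 2 *
      (1 / (Nat.factorial m : ℚ) +
        2 / ((Nat.factorial (m - 2) : ℚ) * ((n + 1 - m : ℕ) : ℚ) * ((n + m : ℕ) : ℚ))) := by
  classical
  have hset : ∀ i : Fin n, i ∈ (univ.filter fun i : Fin n => (i : ℕ) < m) ↔ (i : ℕ) < m := by
    intro i; simp
  have hcard : (univ.filter fun i : Fin n => (i : ℕ) < m).card = m := by
    rw [Fin.card_filter_val_lt]
    omega
  rw [← main_cc hn hm2 hm heven _ hcard, Nat.card_eq_fintype_card, Fintype.card_subtype, cc]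
  congr 2
  ext p
  simp only [Finset.mem_filter, Finset.mem_univ, true_and, fullCycle_iff hn]
  refine and_congr_right fun _ => and_congr_right fun _ => ?_
  constructor
  · intro h i hi j hj
    exact h i j ((hset i).1 hi) ((hset j).1 hj)
  · intro h i j hi hj
    exact h i ((hset i).2 hi) j ((hset j).2 hj)
end
end

section
/- Let n ≥ 2. Then the sum, over all ordered pairs (u, v) of n-cycles on [n], of the number of fixed points of the product u∘v equals n·(n−1)!·(n−2)!. In particular, the expected number of fixed points in the product of two independent uniformly random n-cycles is n/(n−1). -/
open Equiv Finset

noncomputable section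

lemma full_iff {n : ℕ} (hn : 2 ≤ n) (σ : Equiv.Perm (Fin n)) :
    IsFullCycle σ ↔ σ.cycleType = {n} := by
  have h1 := Equiv.Perm.sum_cycleType σ
  have h2 : (Finset.univ.filter fun x => σ x = x).card + σ.support.card = n := by
    have := Finset.card_filter_add_card_filter_not (s := (Finset.univ : Finset (Fin n)))
      (fun x => σ x = x)
    simpa [Equiv.Perm.support] using this
  unfold IsFullCycle cycleCount
  constructor
  · intro h
    rcases Nat.eq_zero_or_pos σ.cycleType.card with h0 | h0
    · rw [Multiset.card_eq_zero.mp h0] at h1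
      simp at h1
      omega
    · obtain ⟨a, ha⟩ := Multiset.card_eq_one.mp (show σ.cycleType.card = 1 by omega)
      rw [ha] at h1 ⊢
      simp at h1
      congr 1
      omega
  · intro h
    rw [h] at h1 ⊢
    simp at h1 ⊢
    intro x hx
    have : (Finset.univ.filter fun x => σ x = x).card = 0 := by omega
    rw [Finset.card_eq_zero] at this
    have h3 : x ∈ (Finset.univ.filter fun x => σ x = x) := by simp [hx]
    rw [this] at h3
    simp at h3

lemma full_ne {n : ℕ} (hn : 2 ≤ n) (σ : Equiv.Perm (Fin n)) (h : σ.cycleType = {n})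
    (x : Fin n) : σ x ≠ x := by
  have h1 := Equiv.Perm.sum_cycleType σ
  rw [h] at h1
  simp at h1
  have : σ.support = Finset.univ := by
    rw [← Finset.card_eq_iff_eq_univ]; simp [← h1]
  have h3 : x ∈ σ.support := by rw [this]; simp
  simpa using h3

lemma card_full {n : ℕ} (hn : 2 ≤ n) :
    (Finset.univ.filter fun σ : Equiv.Perm (Fin n) => σ.cycleType = {n}).card
      = Nat.factorial (n - 1) := by
  have := Equiv.Perm.card_of_cycleType_singleton (α := Fin n) (n := n) hn (by simp)
  simpa using this

lemma card_le' {n : ℕ} (x y z : Fin n) (hy : y ≠ x) (hz : z ≠ x) :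
    (Finset.univ.filter fun σ : Equiv.Perm (Fin n) => σ.cycleType = {n} ∧ σ x = y).card ≤
    (Finset.univ.filter fun σ : Equiv.Perm (Fin n) => σ.cycleType = {n} ∧ σ x = z).card := by
  apply Finset.card_le_card_of_injOn (fun v => Equiv.swap y z * v * (Equiv.swap y z)⁻¹)
  · intro v hv
    simp only [Finset.coe_filter, Finset.mem_univ, true_and, Set.mem_setOf_eq] at hv ⊢
    refine ⟨by rw [Equiv.Perm.cycleType_conj]; exact hv.1, ?_⟩
    simp [Equiv.swap_apply_of_ne_of_ne hy.symm hz.symm, hv.2]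
  · intro a _ b _ h
    simpa using h

lemma card_xy {n : ℕ} (hn : 2 ≤ n) (x y : Fin n) (hy : y ≠ x) :
    (Finset.univ.filter fun σ : Equiv.Perm (Fin n) => σ.cycleType = {n} ∧ σ x = y).card
      = Nat.factorial (n - 2) := by
  have h1 := Finset.card_eq_sum_card_fiberwise (f := fun σ : Equiv.Perm (Fin n) => σ x)
    (s := Finset.univ.filter fun σ : Equiv.Perm (Fin n) => σ.cycleType = {n})
    (t := Finset.univ.erase x) (by
      intro σ hs
      simp at hs ⊢
      exact full_ne hn σ hs x)
  rw [card_full hn, Finset.sum_congr rfl (g := fun _ =>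
    (Finset.univ.filter fun σ : Equiv.Perm (Fin n) => σ.cycleType = {n} ∧ σ x = y).card)] at h1
  · simp only [Finset.sum_const, Finset.card_erase_of_mem (Finset.mem_univ x),
      Finset.card_univ, Fintype.card_fin, smul_eq_mul] at h1
    obtain ⟨m, rfl⟩ := Nat.exists_eq_add_of_le' hn
    simp only [show m + 2 - 1 = m + 1 by omega, show m + 2 - 2 = m by omega,
      Nat.factorial_succ] at h1 ⊢
    exact (Nat.eq_of_mul_eq_mul_left (Nat.succ_pos m) h1).symm
  · intro z hz
    rw [Finset.filter_filter]
    have hz' : z ≠ x := by simpa using hz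
    exact le_antisymm (card_le' x z y hz' hy) (card_le' x y z hy hz')

open scoped Classical in
/-- For `n ≥ 2`, the sum over all ordered pairs `(u, v)` of `n`-cycles on
`[n]` of the number of fixed points of `u ∘ v` equals `n (n-1)! (n-2)!`; in particular the
expected number of fixed points of the product of two uniform random `n`-cycles is
`n/(n-1)`. -/
theorem expected_fixed_points (n : ℕ) (hn : 2 ≤ n) :
    ∑ p ∈ Finset.univ.filter
        (fun p : Equiv.Perm (Fin n) × Equiv.Perm (Fin n) =>
          IsFullCycle p.1 ∧ IsFullCycle p.2),
      (Finset.univ.filter fun x : Fin n => (p.1 * p.2) x = x).card =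
    n * Nat.factorial (n - 1) * Nat.factorial (n - 2) := by
  have key : ∀ u v : Equiv.Perm (Fin n), ∀ x, (u * v) x = x ↔ v x = u⁻¹ x := by
    intro u v x
    rw [Equiv.Perm.mul_apply, Equiv.Perm.eq_inv_iff_eq]
  simp only [full_iff hn, Finset.card_filter, key]
  rw [← Finset.univ_product_univ, Finset.filter_product
    (fun u : Equiv.Perm (Fin n) => u.cycleType = {n})
    (fun u : Equiv.Perm (Fin n) => u.cycleType = {n}), Finset.sum_product]
  have h : ∀ u ∈ Finset.univ.filter (fun u : Equiv.Perm (Fin n) => u.cycleType = {n}),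
      (∑ v ∈ Finset.univ.filter (fun u : Equiv.Perm (Fin n) => u.cycleType = {n}),
        ∑ x : Fin n, if v x = u⁻¹ x then 1 else 0) = n * Nat.factorial (n - 2) := by
    intro u hu
    rw [Finset.sum_comm, Finset.sum_congr rfl (g := fun _ => Nat.factorial (n - 2))]
    · simp
    · intro x _
      rw [← Finset.card_filter, Finset.filter_filter]
      have hu' : u.cycleType = {n} := by simpa using hu
      have hne : u⁻¹ x ≠ x := full_ne hn u⁻¹ (by rw [Equiv.Perm.cycleType_inv, hu']) x
      convert card_xy hn x (u⁻¹ x) hne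
  rw [Finset.sum_congr rfl h, Finset.sum_const, smul_eq_mul]
  have hc := card_full hn
  rw [show (Finset.univ.filter fun σ : Equiv.Perm (Fin n) => σ.cycleType = {n}).card
    = Nat.factorial (n - 1) by convert hc]
  ring
end
end
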